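/- Let Γ be a group and σ : Γ × Γ → ℤ a function, and suppose there is a 2-cycle (N; x_1,…,x_N; a_1,…,a_N; b_1,…,b_N) on Γ with Σ_{j=1}^N x_j·σ(a_j, b_j) ≠ 0. Let (k_n)_{n≥1} be a sequence of positive integers and for each n ≥ 1 let ρ_n : Γ → U(k_n) be a map into the k_n×k_n complex unitary matrices satisfying ρ_n(gh) ρ_n(h)^{-1} ρ_n(g)^{-1} = exp((2πi/n)·σ(g,h)) · I for all g, h ∈ Γ. Then there is no sequence of group homomorphisms ψ_n : Γ → U(k_n) such that ‖ψ_n(g) − ρ_n(g)‖_op → 0 as n → ∞ for every g ∈ Γ. -/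

import Mathlib

open Filter

/-- The data `(x_j, a_j, b_j)_{j=1}^N` is a 2-cycle on `Γ` when
`Σ_j x_j([a_j] − [a_j b_j] + [b_j]) = 0` in the free abelian group `ℤ[Γ]`. -/
def IsTwoCycle {Γ : Type*} [Group Γ] {N : ℕ} (x : Fin N → ℤ) (a b : Fin N → Γ) : Prop :=
  ∑ j : Fin N,
    (Finsupp.single (a j) (x j) - Finsupp.single (a j * b j) (x j)
      + Finsupp.single (b j) (x j)) = (0 : Γ →₀ ℤ)

/-- The operator norm of a square complex matrix acting on the corresponding ℓ² space. -/
noncomputable def l2OpNorm {k : ℕ} (M : Matrix (Fin k) (Fin k) ℂ) : ℝ :=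
  ‖LinearMap.toContinuousLinearMap (Matrix.toEuclideanLin M)‖

open scoped Matrix.Norms.L2Operator
open Unitary selfAdjoint Metric

theorem det_expUnitary {m : Type*} [Fintype m] [DecidableEq m] (A : selfAdjoint (Matrix m m ℂ)) :
    (expUnitary A : Matrix m m ℂ).det = Complex.exp (Complex.I * (A : Matrix m m ℂ).trace) := by
  have hA : (A : Matrix m m ℂ).IsHermitian := A.2
  set U : Matrix m m ℂ := (hA.eigenvectorUnitary : Matrix m m ℂ)
  have hUinv : U⁻¹ = star U :=
    Matrix.inv_eq_right_inv (Unitary.mul_star_self_of_mem hA.eigenvectorUnitary.2)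
  have hUu : IsUnit U := (Unitary.toUnits hA.eigenvectorUnitary).isUnit
  have key : Complex.I • (A : Matrix m m ℂ)
      = U * Matrix.diagonal (fun i => Complex.I * (hA.eigenvalues i : ℂ)) * U⁻¹ := by
    conv_lhs => rw [hA.spectral_theorem]
    rw [hUinv, Unitary.conjStarAlgAut_apply, ← Matrix.smul_mul, ← Matrix.mul_smul,
      ← Matrix.diagonal_smul]
    rfl
  rw [expUnitary_coe, key, Matrix.exp_conj _ _ hUu, Matrix.exp_diagonal,
    Matrix.det_conj hUu, Matrix.det_diagonal, hA.trace_eq_sum_eigenvalues, Finset.mul_sum,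
    Complex.exp_sum]
  simp [Pi.coe_exp, Complex.exp_eq_exp_ℂ]

/-- The real number `tr (-i log u)`, for the principal branch of the logarithm. -/
noncomputable def traceArg {m : Type*} [Fintype m] [DecidableEq m]
    (u : unitary (Matrix m m ℂ)) : ℝ :=
  (argSelfAdjoint u : Matrix m m ℂ).trace.re

section traceArg

variable {m : Type*} [Fintype m] [DecidableEq m]

theorem coe_traceArg (u : unitary (Matrix m m ℂ)) :
    (traceArg u : ℂ) = (argSelfAdjoint u : Matrix m m ℂ).trace := by
  rw [traceArg, ← Complex.conj_eq_iff_re]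
  have h : (argSelfAdjoint u : Matrix m m ℂ).IsHermitian := (argSelfAdjoint u).2
  rw [starRingEnd_apply, ← Matrix.trace_conjTranspose, h.eq]

theorem exp_traceArg {u : unitary (Matrix m m ℂ)} (hu : u ∈ ball 1 2) :
    Complex.exp (Complex.I * traceArg u) = (u : Matrix m m ℂ).det := by
  rw [coe_traceArg, ← det_expUnitary, expUnitary_argSelfAdjoint]
  simpa [Subtype.dist_eq, dist_eq_norm] using hu

theorem continuousOn_traceArg :
    ContinuousOn (traceArg : unitary (Matrix m m ℂ) → ℝ) (ball 1 2) := by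
  unfold traceArg
  have h1 : Continuous fun A : selfAdjoint (Matrix m m ℂ) => (A : Matrix m m ℂ).trace.re :=
    Complex.continuous_re.comp (Continuous.matrix_trace continuous_subtype_val)
  exact h1.comp_continuousOn continuousOn_argSelfAdjoint

theorem traceArg_one : traceArg (1 : unitary (Matrix m m ℂ)) = 0 := by
  have h := argSelfAdjoint_expUnitary (x := (0 : selfAdjoint (Matrix m m ℂ)))
    (by simpa using Real.pi_pos)
  rw [expUnitary_zero] at h
  simp [traceArg, h]

/-- A continuous real function on the unit ball about `1` in the unitary group, with values in
`2πℤ` and vanishing at `1`, vanishes identically. -/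
theorem eq_zero_of_exp_eq_one {g : unitary (Matrix m m ℂ) → ℝ} (hg : ContinuousOn g (ball 1 1))
    (hexp : ∀ v ∈ ball (1 : unitary (Matrix m m ℂ)) 1, Complex.exp (Complex.I * g v) = 1)
    (h1 : g 1 = 0) {v : unitary (Matrix m m ℂ)} (hv : v ∈ ball 1 1) : g v = 0 := by
  rw [← h1]
  have hpi : (2 * Real.pi) ≠ 0 := by positivity
  have hS : IsPreconnected (ball (1 : unitary (Matrix m m ℂ)) 1) :=
    (isPathConnected_ball 1 1 one_pos one_lt_two).isConnected.isPreconnected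
  have hT : IsDiscrete (Set.range ((↑) : ℤ → ℝ)) :=
    Int.isClosedEmbedding_coe_real.isEmbedding.isDiscrete_range
  have h := hS.constant_of_mapsTo hT (f := fun v => g v / (2 * Real.pi))
    (hg.div_const _) ?_ hv (mem_ball_self one_pos)
  · simpa [div_left_inj' hpi] using h
  · intro w hw
    obtain ⟨n, hn⟩ := Complex.exp_eq_one_iff.1 (hexp w hw)
    refine ⟨n, ?_⟩
    have h2 : (g w : ℂ) = (n * (2 * Real.pi) : ℝ) := by
      apply mul_left_cancel₀ Complex.I_ne_zero
      rw [hn]; push_cast; ring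
    have h3 : g w = n * (2 * Real.pi) := by exact_mod_cast h2
    simp only [h3, mul_div_cancel_right₀ _ hpi]

theorem mul_mem_ball_one {u v : unitary (Matrix m m ℂ)} {r s : ℝ}
    (hu : u ∈ ball 1 r) (hv : v ∈ ball 1 s) : u * v ∈ ball 1 (r + s) := by
  rw [mem_ball, Subtype.dist_eq, dist_eq_norm] at *
  calc ‖((u * v : unitary (Matrix m m ℂ)) : Matrix m m ℂ) - (1 : unitary (Matrix m m ℂ))‖
      = ‖((u : Matrix m m ℂ) - 1) * v + ((v : Matrix m m ℂ) - 1)‖ := by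
        congr 1; push_cast; noncomm_ring
    _ ≤ ‖((u : Matrix m m ℂ) - 1) * v‖ + ‖(v : Matrix m m ℂ) - 1‖ := norm_add_le _ _
    _ = ‖(u : Matrix m m ℂ) - 1‖ + ‖(v : Matrix m m ℂ) - 1‖ := by simp
    _ < r + s := add_lt_add hu hv

theorem traceArg_mul {u v : unitary (Matrix m m ℂ)} (hu : u ∈ ball 1 1) (hv : v ∈ ball 1 1) :
    traceArg (u * v) = traceArg u + traceArg v := by
  have hsub : ball (1 : unitary (Matrix m m ℂ)) 1 ⊆ ball 1 2 := ball_subset_ball one_le_two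
  have hmul : ∀ w ∈ ball (1 : unitary (Matrix m m ℂ)) 1, u * w ∈ ball 1 2 := fun w hw => by
    simpa only [one_add_one_eq_two] using mul_mem_ball_one hu hw
  have h := eq_zero_of_exp_eq_one (g := fun w => traceArg (u * w) - (traceArg u + traceArg w))
    ?_ ?_ ?_ hv
  · linarith
  · exact (continuousOn_traceArg.comp (by fun_prop) hmul).sub
      (continuousOn_const.add (continuousOn_traceArg.mono hsub))
  · intro w hw
    push_cast
    rw [mul_sub, mul_add, Complex.exp_sub, Complex.exp_add, exp_traceArg (hmul w hw),
      exp_traceArg (hsub hu), exp_traceArg (hsub hw), Submonoid.coe_mul, Matrix.det_mul, div_self]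
    rw [← exp_traceArg (hsub hu), ← exp_traceArg (hsub hw)]
    exact mul_ne_zero (Complex.exp_ne_zero _) (Complex.exp_ne_zero _)
  · simp [traceArg_one]

theorem conj_mem_ball_one (w : unitary (Matrix m m ℂ)) {u : unitary (Matrix m m ℂ)} {r : ℝ}
    (hu : u ∈ ball 1 r) : w * u * w⁻¹ ∈ ball 1 r := by
  rw [mem_ball] at *
  calc dist (w * u * w⁻¹) 1 = dist (w * u * w⁻¹) (w * 1 * w⁻¹) := by simp
    _ = dist u 1 := by
      simp only [Subtype.dist_eq, dist_eq_norm, Submonoid.coe_mul, ← sub_mul, ← mul_sub]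
      rw [CStarRing.norm_mul_coe_unitary, CStarRing.norm_coe_unitary_mul]
    _ < r := hu

theorem traceArg_conj (w : unitary (Matrix m m ℂ)) {u : unitary (Matrix m m ℂ)}
    (hu : u ∈ ball 1 1) : traceArg (w * u * w⁻¹) = traceArg u := by
  have hsub : ball (1 : unitary (Matrix m m ℂ)) 1 ⊆ ball 1 2 := ball_subset_ball one_le_two
  have h := eq_zero_of_exp_eq_one (g := fun v => traceArg (w * v * w⁻¹) - traceArg v) ?_ ?_ ?_ hu
  · linarith
  · exact (continuousOn_traceArg.comp (by fun_prop) fun v hv => hsub (conj_mem_ball_one w hv)).sub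
      (continuousOn_traceArg.mono hsub)
  · intro v hv
    have hdet : ((w * v * w⁻¹ : unitary (Matrix m m ℂ)) : Matrix m m ℂ).det
        = (v : Matrix m m ℂ).det := by
      have h1 : (w : Matrix m m ℂ).det * ((w⁻¹ : unitary (Matrix m m ℂ)) : Matrix m m ℂ).det
          = 1 := by
        rw [← Matrix.det_mul, ← Submonoid.coe_mul, mul_inv_cancel]; simp
      rw [Submonoid.coe_mul, Submonoid.coe_mul, Matrix.det_mul, Matrix.det_mul, mul_right_comm,
        h1, one_mul]
    push_cast
    rw [mul_sub, Complex.exp_sub, exp_traceArg (hsub (conj_mem_ball_one w hv)),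
      exp_traceArg (hsub hv), hdet, div_self]
    rw [← exp_traceArg (hsub hv)]
    exact Complex.exp_ne_zero _
  · simp [traceArg_one]

theorem coe_expUnitary_smul_one (θ : ℝ) :
    (expUnitary (θ • (1 : selfAdjoint (Matrix m m ℂ))) : Matrix m m ℂ)
      = Complex.exp (θ * Complex.I) • (1 : Matrix m m ℂ) := by
  have h : Complex.I • ((θ • (1 : selfAdjoint (Matrix m m ℂ)) : selfAdjoint (Matrix m m ℂ)) :
      Matrix m m ℂ) = algebraMap ℂ (Matrix m m ℂ) (θ * Complex.I) := by
    rw [Algebra.algebraMap_eq_smul_one, mul_comm, mul_smul]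
    simp
  rw [expUnitary_coe, h, ← NormedSpace.algebraMap_exp_comm, Algebra.algebraMap_eq_smul_one,
    Complex.exp_eq_exp_ℂ]

theorem traceArg_expUnitary_smul_one [Nonempty m] {θ : ℝ} (hθ : |θ| < Real.pi) :
    traceArg (expUnitary (θ • (1 : selfAdjoint (Matrix m m ℂ)))) = Fintype.card m * θ := by
  rw [traceArg, argSelfAdjoint_expUnitary]
  · simp [mul_comm]
  · change ‖θ • (1 : Matrix m m ℂ)‖ < Real.pi
    simpa [norm_smul] using hθ

theorem expUnitary_smul_one_mem_ball {θ r : ℝ} (hθ : |θ| < r) :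
    expUnitary (θ • (1 : selfAdjoint (Matrix m m ℂ))) ∈ ball 1 r := by
  rw [mem_ball, Subtype.dist_eq, dist_eq_norm, coe_expUnitary_smul_one]
  have h : Complex.exp (θ * Complex.I) • (1 : Matrix m m ℂ) - (1 : unitary (Matrix m m ℂ))
      = (Complex.exp (Complex.I * θ) - 1) • (1 : Matrix m m ℂ) := by
    rw [sub_smul, mul_comm]; simp
  rw [h, norm_smul]
  calc _ ≤ ‖Complex.exp (Complex.I * θ) - 1‖ * 1 := by
        gcongr
        nontriviality (Matrix m m ℂ)
        simp
    _ ≤ |θ| := by simpa using Real.norm_exp_I_mul_ofReal_sub_one_le (x := θ)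
    _ < r := hθ

/-- If `ρ` is close to a homomorphism `ψ` at `g` and `h` and multiplicative there up to a small
phase `θ`, then `g ↦ traceArg (ρ g * (ψ g)⁻¹)` has coboundary `card m * θ`. -/
theorem traceArg_perturbation [Nonempty m] {Γ : Type*} [Group Γ]
    {ρ : Γ → unitary (Matrix m m ℂ)} {ψ : Γ →* unitary (Matrix m m ℂ)} {g h : Γ} {θ : ℝ}
    (hθ : |θ| < 1)
    (hρ : ρ (g * h) * (ρ h)⁻¹ * (ρ g)⁻¹ = expUnitary (θ • (1 : selfAdjoint (Matrix m m ℂ))))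
    (hg : ρ g * (ψ g)⁻¹ ∈ ball 1 (1 / 2)) (hh : ρ h * (ψ h)⁻¹ ∈ ball 1 (1 / 2)) :
    traceArg (ρ (g * h) * (ψ (g * h))⁻¹)
      = Fintype.card m * θ + (traceArg (ρ g * (ψ g)⁻¹) + traceArg (ρ h * (ψ h)⁻¹)) := by
  have hsub : ball (1 : unitary (Matrix m m ℂ)) (1 / 2) ⊆ ball 1 1 :=
    ball_subset_ball (by norm_num)
  have heq : ρ (g * h) * (ψ (g * h))⁻¹ = expUnitary (θ • (1 : selfAdjoint (Matrix m m ℂ))) *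
      ((ρ g * (ψ g)⁻¹) * (ψ g * (ρ h * (ψ h)⁻¹) * (ψ g)⁻¹)) := by
    rw [← hρ, map_mul]
    group
  have hc := conj_mem_ball_one (ψ g) hh
  have hprod := mul_mem_ball_one hg hc
  rw [add_halves] at hprod
  rw [heq, traceArg_mul (expUnitary_smul_one_mem_ball hθ) hprod,
    traceArg_mul (hsub hg) (hsub hc), traceArg_conj _ (hsub hh),
    traceArg_expUnitary_smul_one (hθ.trans (by linarith [Real.pi_gt_three]))]

end traceArg

theorem IsTwoCycle.sum_eq_zero {Γ : Type*} [Group Γ] {N : ℕ} {x : Fin N → ℤ} {a b : Fin N → Γ}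
    (h : IsTwoCycle x a b) (f : Γ → ℝ) :
    ∑ j, (x j : ℝ) * (f (a j) - f (a j * b j) + f (b j)) = 0 := by
  have h1 := congrArg (Finsupp.liftAddHom fun g => (AddMonoidHom.mulRight (f g)).comp
    (Int.castAddHom ℝ)) h
  rw [map_sum, map_zero] at h1
  rw [← h1]
  refine Finset.sum_congr rfl fun j _ => ?_
  simp only [map_add, map_sub, Finsupp.liftAddHom_apply_single, AddMonoidHom.comp_apply,
    Int.coe_castAddHom, AddMonoidHom.mulRight_apply]
  ring

theorem l2OpNorm_eq_norm {k : ℕ} (M : Matrix (Fin k) (Fin k) ℂ) : l2OpNorm M = ‖M‖ := rfl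

/-- Suppose `σ : Γ × Γ → ℤ` pairs nontrivially with a 2-cycle, `(k_n)` is a sequence
of positive integers, and for each `n ≥ 1` the map `ρ_n : Γ → U(k_n)` satisfies
`ρ_n(gh) ρ_n(h)⁻¹ ρ_n(g)⁻¹ = exp((2πi/n)·σ(g,h)) • I`. Then there is no sequence of
group homomorphisms `ψ_n : Γ → U(k_n)` with `‖ψ_n(g) − ρ_n(g)‖_op → 0` for every `g`. -/
theorem projective_rep_not_perturbable {Γ : Type*} [Group Γ] (σ : Γ × Γ → ℤ)
    (N : ℕ) (x : Fin N → ℤ) (a b : Fin N → Γ) (hcycle : IsTwoCycle x a b)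
    (hpair : ∑ j : Fin N, x j * σ (a j, b j) ≠ 0)
    (k : ℕ → ℕ) (hk : ∀ n, 1 ≤ k n)
    (ρ : ∀ n : ℕ, Γ → Matrix.unitaryGroup (Fin (k n)) ℂ)
    (hρ : ∀ n : ℕ, 1 ≤ n → ∀ g h : Γ,
      (ρ n (g * h) : Matrix (Fin (k n)) (Fin (k n)) ℂ) *
          ((ρ n h)⁻¹ : Matrix.unitaryGroup (Fin (k n)) ℂ) *
          ((ρ n g)⁻¹ : Matrix.unitaryGroup (Fin (k n)) ℂ) =
        Complex.exp (2 * Real.pi * Complex.I / n * σ (g, h)) •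
          (1 : Matrix (Fin (k n)) (Fin (k n)) ℂ)) :
    ¬ ∃ ψ : ∀ n : ℕ, Γ →* Matrix.unitaryGroup (Fin (k n)) ℂ,
        ∀ g : Γ,
          Tendsto
            (fun n : ℕ =>
              l2OpNorm ((ψ n g : Matrix (Fin (k n)) (Fin (k n)) ℂ) - (ρ n g : Matrix (Fin (k n)) (Fin (k n)) ℂ)))
            atTop (nhds 0) := by
  rintro ⟨ψ, hψ⟩
  have hclose : ∀ g : Γ, ∀ᶠ n in atTop, ρ n g * (ψ n g)⁻¹ ∈ ball 1 (1 / 2) := fun g => by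
    filter_upwards [(hψ g).eventually_lt_const (show (0 : ℝ) < 1 / 2 by norm_num)] with n hn
    rw [l2OpNorm_eq_norm, norm_sub_rev, Unitary.norm_sub_eq] at hn
    rwa [mem_ball, Subtype.dist_eq, dist_eq_norm]
  have hphase : ∀ g h : Γ, ∀ᶠ n : ℕ in atTop, |2 * Real.pi / n * σ (g, h)| < 1 := fun g h => by
    have h1 : Tendsto (fun n : ℕ => |2 * Real.pi / n * σ (g, h)|) atTop (nhds 0) := by
      simpa using ((tendsto_const_div_atTop_nhds_zero_nat (2 * Real.pi)).mul_const
        (σ (g, h) : ℝ)).abs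
    exact h1.eventually_lt_const one_pos
  have hall : ∀ᶠ n : ℕ in atTop, 1 ≤ n ∧ ∀ j : Fin N,
      ρ n (a j) * (ψ n (a j))⁻¹ ∈ ball 1 (1 / 2) ∧ ρ n (b j) * (ψ n (b j))⁻¹ ∈ ball 1 (1 / 2) ∧
        |2 * Real.pi / n * σ (a j, b j)| < 1 :=
    (eventually_ge_atTop 1).and <| eventually_all.2 fun j =>
      (hclose (a j)).and ((hclose (b j)).and (hphase (a j) (b j)))
  obtain ⟨n, hn, hj⟩ := hall.exists
  have : NeZero (k n) := ⟨(Nat.one_le_iff_ne_zero.1 (hk n))⟩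
  have hn0 : (n : ℝ) ≠ 0 := by positivity
  have hk0 : (k n : ℝ) ≠ 0 := by exact_mod_cast NeZero.ne (k n)
  have hcob : ∀ j, traceArg (ρ n (a j * b j) * (ψ n (a j * b j))⁻¹) =
      k n * (2 * Real.pi / n * σ (a j, b j)) +
        (traceArg (ρ n (a j) * (ψ n (a j))⁻¹) + traceArg (ρ n (b j) * (ψ n (b j))⁻¹)) := fun j => by
    obtain ⟨ha, hb, hθ⟩ := hj j
    have hrel : ρ n (a j * b j) * (ρ n (b j))⁻¹ * (ρ n (a j))⁻¹ = expUnitary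
        ((2 * Real.pi / n * σ (a j, b j) : ℝ) • (1 : selfAdjoint (Matrix _ _ ℂ))) := by
      refine Subtype.ext ((hρ n hn (a j) (b j)).trans ?_)
      rw [coe_expUnitary_smul_one]
      congr 2
      push_cast
      ring
    simpa using traceArg_perturbation hθ hrel ha hb
  have hsum := hcycle.sum_eq_zero fun g => traceArg (ρ n g * (ψ n g)⁻¹)
  simp only [hcob] at hsum
  have hfactor : -(k n * (2 * Real.pi / n)) * ∑ j, (x j : ℝ) * σ (a j, b j) = 0 := by
    rw [← hsum, Finset.mul_sum]
    refine Finset.sum_congr rfl fun j _ => ?_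
    ring
  refine hpair ?_
  have hne : -(k n * (2 * Real.pi / n)) ≠ 0 :=
    neg_ne_zero.2 (mul_ne_zero hk0 (div_ne_zero (by positivity) hn0))
  exact_mod_cast (mul_eq_zero.1 hfactor).resolve_left hne
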